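/- arXiv:2202.13641 — 3 statements merged into one kernel-verified Lean document; each statement's English description precedes it below -/
import Mathlib

section
/- Let Δ ≥ 2, let p, r_B be integers with 0 < p < r_B < Δ, let α > 0 and let d be a real number with d ≥ 2αΔ + 2√Δ/log₂Δ. Let C_A ⊆ F₂^A (with A and B index sets of size Δ) be a linear code of minimum distance d_A ≥ d. Let P ⊆ B with |P| = p, and let X_p be a fixed Δ×(Δ−p) matrix over F₂ (with columns indexed by B∖P) all of whose columns have Hamming weight at most √Δ/log₂Δ and having at least d/2 nonzero rows. Let 𝒳_P be the set of Δ×Δ matrices over F₂ whose restriction to the columns indexed by B∖P equals X_p. Let C_B be the kernel of a uniformly random r_B×Δ matrix over F₂. Then the probability that the dual tensor code C_A ⊗ F₂^B + F₂^A ⊗ C_B contains at least one matrix of 𝒳_P is at most 2^{−(r_B−p)·α√Δ·log₂Δ}. -/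
noncomputable section

/-- Hamming weight of a binary word. -/
def wt {ι : Type*} (x : ι → ZMod 2) : ℕ := {i | x i ≠ 0}.ncard

/-- Hamming distance from a word to a set of words. -/
def distTo {ι : Type*} (x : ι → ZMod 2) (S : Set (ι → ZMod 2)) : ℕ :=
  sInf {d : ℕ | ∃ c ∈ S, wt (x - c) = d}

/-- Minimum distance of a linear code. -/
def minDist {ι : Type*} (C : Submodule (ZMod 2) (ι → ZMod 2)) : ℕ :=
  sInf {d : ℕ | ∃ c ∈ C, c ≠ 0 ∧ wt c = d}

/-- Dual code with respect to the standard bilinear form. -/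
def dualCode {ι : Type*} [Finite ι] (C : Submodule (ZMod 2) (ι → ZMod 2)) :
    Submodule (ZMod 2) (ι → ZMod 2) :=
  letI := Fintype.ofFinite ι
  { carrier := {x | ∀ c ∈ C, ∑ i, x i * c i = 0}
    add_mem' := by
      intro x y hx hy c hc
      have h : ∑ i, (x + y) i * c i = (∑ i, x i * c i) + ∑ i, y i * c i := by
        simp [add_mul, Finset.sum_add_distrib]
      simp only [Set.mem_setOf_eq] at *
      rw [h, hx c hc, hy c hc, add_zero]
    zero_mem' := by
      simp
    smul_mem' := by
      intro t x hx c hc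
      have h : ∑ i, (t • x) i * c i = t * ∑ i, x i * c i := by
        simp [Finset.mul_sum, mul_assoc]
      simp only [Set.mem_setOf_eq] at *
      rw [h, hx c hc, mul_zero] }

/-- The code of matrices all of whose columns lie in `CA`. -/
def colCode {A : Type*} (B : Type*) (CA : Submodule (ZMod 2) (A → ZMod 2)) :
    Submodule (ZMod 2) (A × B → ZMod 2) where
  carrier := {x | ∀ b : B, (fun a => x (a, b)) ∈ CA}
  add_mem' := by intro x y hx hy b; exact CA.add_mem (hx b) (hy b)
  zero_mem' := by intro b; exact CA.zero_mem
  smul_mem' := by intro t x hx b; exact CA.smul_mem t (hx b)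

/-- The code of matrices all of whose rows lie in `CB`. -/
def rowCode (A : Type*) {B : Type*} (CB : Submodule (ZMod 2) (B → ZMod 2)) :
    Submodule (ZMod 2) (A × B → ZMod 2) where
  carrier := {x | ∀ a : A, (fun b => x (a, b)) ∈ CB}
  add_mem' := by intro x y hx hy a; exact CB.add_mem (hx a) (hy a)
  zero_mem' := by intro a; exact CB.zero_mem
  smul_mem' := by intro t x hx a; exact CB.smul_mem t (hx a)

/-- Tensor code `C_A ⊗ C_B`. -/
def tensorCode {A B : Type*} (CA : Submodule (ZMod 2) (A → ZMod 2))
    (CB : Submodule (ZMod 2) (B → ZMod 2)) : Submodule (ZMod 2) (A × B → ZMod 2) :=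
  colCode B CA ⊓ rowCode A CB

/-- Dual tensor code `C_A ⊗ F₂^B + F₂^A ⊗ C_B`. -/
def dualTensor {A B : Type*} (CA : Submodule (ZMod 2) (A → ZMod 2))
    (CB : Submodule (ZMod 2) (B → ZMod 2)) : Submodule (ZMod 2) (A × B → ZMod 2) :=
  colCode B CA ⊔ rowCode A CB

/-- `w`-robustness of the dual tensor code of `CA` and `CB`. -/
def IsRobust {A B : Type*} (CA : Submodule (ZMod 2) (A → ZMod 2))
    (CB : Submodule (ZMod 2) (B → ZMod 2)) (w : ℝ) : Prop :=
  ∀ c ∈ dualTensor CA CB, (wt c : ℝ) ≤ w →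
    ∃ (A' : Set A) (B' : Set B),
      (A'.ncard : ℝ) ≤ (wt c : ℝ) / (minDist CB : ℝ) ∧
      (B'.ncard : ℝ) ≤ (wt c : ℝ) / (minDist CA : ℝ) ∧
      ∀ a b, a ∉ A' → b ∉ B' → c (a, b) = 0

/-- Punctured code: restrictions of codewords of `C` to the coordinates in `A'`. -/
def punct {A : Type*} (C : Submodule (ZMod 2) (A → ZMod 2)) (A' : Set A) :
    Submodule (ZMod 2) (↥A' → ZMod 2) :=
  C.map (LinearMap.funLeft (ZMod 2) (ZMod 2) ((↑) : ↥A' → A))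

/-- `w`-robustness with `p`-resistance to puncturing. -/
def IsRobustPunct {A B : Type*} [Finite A] [Finite B]
    (CA : Submodule (ZMod 2) (A → ZMod 2)) (CB : Submodule (ZMod 2) (B → ZMod 2))
    (w p : ℝ) : Prop :=
  ∀ (A' : Set A) (B' : Set B) (w' : ℕ), (w' : ℝ) ≤ p →
    A'.ncard + w' = Nat.card A → B'.ncard + w' = Nat.card B →
    IsRobust (punct CA A') (punct CB B') w

section Complex

variable {G : Type*} [Group G] [DecidableEq G]

/-- Total no-conjugacy condition. -/
def TNC (A B : Set G) : Prop := ∀ g : G, ∀ a ∈ A, ∀ b ∈ B, a * g ≠ g * b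

/-- The square associated to `(g, a, b)`. -/
def cpxSq (g a b : G) : Finset (G × Bool) :=
  {(g, false), (a * g, true), (g * b, true), (a * g * b, false)}

/-- The set `Q` of squares of the left-right Cayley complex. -/
def Squares (A B : Set G) : Set (Finset (G × Bool)) :=
  {q | ∃ g : G, ∃ a ∈ A, ∃ b ∈ B, q = cpxSq g a b}

/-- Local view of `x : F₂^Q` at the vertex `(g, 0) ∈ V₀`, as an element of `F₂^{A×B}`. -/
def lview0 (A B : Set G) (x : ↥(Squares A B) → ZMod 2) (g : G) :
    ↥A × ↥B → ZMod 2 :=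
  fun ab => x ⟨cpxSq g (ab.1 : G) (ab.2 : G), ⟨g, (ab.1 : G), ab.1.2, (ab.2 : G), ab.2.2, rfl⟩⟩

/-- Local view of `x : F₂^Q` at the vertex `(g, 1) ∈ V₁`, as an element of `F₂^{A×B}`. -/
def lview1 {A B : Set G} (hA : ∀ a ∈ A, a⁻¹ ∈ A) (x : ↥(Squares A B) → ZMod 2) (g : G) :
    ↥A × ↥B → ZMod 2 :=
  fun ab => x ⟨cpxSq ((ab.1 : G) * g) (ab.1 : G)⁻¹ (ab.2 : G),
    ⟨(ab.1 : G) * g, (ab.1 : G)⁻¹, hA _ ab.1.2, (ab.2 : G), ab.2.2, rfl⟩⟩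

/-- The classical code 𝒞₀ of the quantum Tanner code: all local views at
vertices of `V₀` lie in `C₀^⊥ = (C_A ⊗ C_B)^⊥`. -/
def qC0 [Finite G] (A B : Set G) (CA : Submodule (ZMod 2) (↥A → ZMod 2))
    (CB : Submodule (ZMod 2) (↥B → ZMod 2)) :
    Submodule (ZMod 2) (↥(Squares A B) → ZMod 2) where
  carrier := {x | ∀ g : G, lview0 A B x g ∈ dualCode (tensorCode CA CB)}
  add_mem' := by
    intro x y hx hy g
    exact (dualCode (tensorCode CA CB)).add_mem (hx g) (hy g)
  zero_mem' := by
    intro g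
    exact (dualCode (tensorCode CA CB)).zero_mem
  smul_mem' := by
    intro t x hx g
    exact (dualCode (tensorCode CA CB)).smul_mem t (hx g)

/-- The classical code 𝒞₁ of the quantum Tanner code: all local views at
vertices of `V₁` lie in `C₁^⊥ = (C_A^⊥ ⊗ C_B^⊥)^⊥`. -/
def qC1 [Finite G] {A B : Set G} (hA : ∀ a ∈ A, a⁻¹ ∈ A)
    (CA : Submodule (ZMod 2) (↥A → ZMod 2)) (CB : Submodule (ZMod 2) (↥B → ZMod 2)) :
    Submodule (ZMod 2) (↥(Squares A B) → ZMod 2) where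
  carrier := {x | ∀ g : G, lview1 hA x g ∈ dualCode (tensorCode (dualCode CA) (dualCode CB))}
  add_mem' := by
    intro x y hx hy g
    exact (dualCode (tensorCode (dualCode CA) (dualCode CB))).add_mem (hx g) (hy g)
  zero_mem' := by
    intro g
    exact (dualCode (tensorCode (dualCode CA) (dualCode CB))).zero_mem
  smul_mem' := by
    intro t x hx g
    exact (dualCode (tensorCode (dualCode CA) (dualCode CB))).smul_mem t (hx g)

/-- Adjacency matrix of the left Cayley graph `Cay(G, A)`. -/
def cayAdjL (A : Set G) : Matrix G G ℝ :=
  fun g g' => A.indicator (fun _ => (1 : ℝ)) (g' * g⁻¹)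

/-- Adjacency matrix of the right Cayley graph `Cay(G, B)`. -/
def cayAdjR (B : Set G) : Matrix G G ℝ :=
  fun g g' => B.indicator (fun _ => (1 : ℝ)) (g⁻¹ * g')

end Complex

/-- A `Δ`-regular graph (given by its adjacency matrix) is Ramanujan if every
eigenvalue other than `±Δ` has absolute value at most `2√(Δ-1)`. -/
def IsRamanujan {V : Type*} [Fintype V] (M : Matrix V V ℝ) (Δ : ℝ) : Prop :=
  ∀ μ : ℝ, (∃ x : V → ℝ, x ≠ 0 ∧ M.mulVec x = μ • x) → μ ≠ Δ → μ ≠ -Δ →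
    |μ| ≤ 2 * Real.sqrt (Δ - 1)

/-- Probability of the event `S` under the uniform distribution on a finite type. -/
def unifProb {Ω : Type*} [Fintype Ω] (S : Set Ω) : ℝ :=
  (S.ncard : ℝ) / (Fintype.card Ω : ℝ)

end

theorem minDist_le_wt {ι : Type*} {C : Submodule (ZMod 2) (ι → ZMod 2)} {c : ι → ZMod 2}
    (hc : c ∈ C) (h0 : c ≠ 0) : minDist C ≤ wt c :=
  Nat.sInf_le ⟨c, hc, h0, rfl⟩

/-- If vectors of weight at most `w` span a space of dimension `r` modulo a code `C` and their
supports cover more than `r * w` coordinates, then `C` has minimum distance at most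
`(r + 1) * w`. -/
theorem minDist_le_of_finrank_span_mkQ {ι β : Type*} [Finite ι] [Finite β]
    (C : Submodule (ZMod 2) (ι → ZMod 2)) (X : β → ι → ZMod 2) {w : ℝ}
    (hw : ∀ b, (wt (X b) : ℝ) ≤ w)
    (hcover : (Module.finrank (ZMod 2) (Submodule.span (ZMod 2) (Set.range (C.mkQ ∘ X))) : ℝ) * w
      < ({a | ∃ b, X b a ≠ 0}.ncard : ℝ)) :
    (minDist C : ℝ) ≤
      (Module.finrank (ZMod 2) (Submodule.span (ZMod 2) (Set.range (C.mkQ ∘ X))) + 1) * w := by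
  classical
  obtain ⟨κ, e, he, hspan, hli⟩ := exists_linearIndependent' (ZMod 2) (C.mkQ ∘ X)
  have := Finite.of_injective e he
  have := Fintype.ofFinite κ
  have hr : Module.finrank (ZMod 2) (Submodule.span (ZMod 2) (Set.range (C.mkQ ∘ X)))
      = Fintype.card κ := by
    rw [← hspan, finrank_span_eq_card hli]
  rw [hr] at hcover ⊢
  set U : Set ι := ⋃ k, {a | X (e k) a ≠ 0} with hU
  have hUcard : (U.ncard : ℝ) ≤ Fintype.card κ * w := by
    calc (U.ncard : ℝ) ≤ ∑ k, (wt (X (e k)) : ℝ) := by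
          exact_mod_cast Set.ncard_iUnion_le_of_fintype _
      _ ≤ ∑ _k : κ, w := Finset.sum_le_sum fun k _ => hw (e k)
      _ = Fintype.card κ * w := by simp
  obtain ⟨a, ⟨b, hab⟩, haU⟩ : ∃ a ∈ {a | ∃ b, X b a ≠ 0}, a ∉ U :=
    Set.exists_mem_notMem_of_ncard_lt_ncard (by exact_mod_cast hUcard.trans_lt hcover)
  have hmem : C.mkQ (X b) ∈ Submodule.span (ZMod 2) (Set.range ((C.mkQ ∘ X) ∘ e)) :=
    hspan ▸ Submodule.subset_span ⟨b, rfl⟩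
  obtain ⟨c, hc⟩ := (Submodule.mem_span_range_iff_exists_fun _).1 hmem
  have hzero : ∀ i ∉ U, (∑ k, c k • X (e k)) i = 0 := by
    intro i hi
    simp only [hU, Set.mem_iUnion, Set.mem_ofPred_eq, not_exists, not_not] at hi
    simp [hi]
  have hC : X b - ∑ k, c k • X (e k) ∈ C := by
    rw [← Submodule.Quotient.mk_eq_zero, ← Submodule.mkQ_apply, map_sub, map_sum, ← hc]
    simp
  have hne : X b - ∑ k, c k • X (e k) ≠ 0 := fun h => hab <| by
    simpa [hzero a haU] using congrFun h a
  have hsub : {i | (X b - ∑ k, c k • X (e k)) i ≠ 0} ⊆ U ∪ {i | X b i ≠ 0} := by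
    intro i hi
    by_contra hni
    simp only [Set.mem_union, not_or, Set.mem_ofPred_eq, not_not] at hni
    exact hi (by rw [Pi.sub_apply, hzero i hni.1, hni.2, sub_zero])
  have hwt : wt (X b - ∑ k, c k • X (e k)) ≤ U.ncard + wt (X b) :=
    (Set.ncard_le_ncard hsub).trans (Set.ncard_union_le _ _)
  have hle : (minDist C : ℝ) ≤ U.ncard + wt (X b) := by
    exact_mod_cast (minDist_le_wt hC hne).trans hwt
  linarith [hw b]

/-- Every functional (valued in any module) that vanishes on `CA` also kills the product of
an element of the dual tensor code with a parity-check row of the row code. -/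
theorem sum_smul_col_eq_zero_of_mem_dualTensor {A B ρ R : Type*} [Fintype B]
    [AddCommGroup R] [Module (ZMod 2) R]
    {CA : Submodule (ZMod 2) (A → ZMod 2)} {N : Matrix ρ B (ZMod 2)} {x : A × B → ZMod 2}
    (hx : x ∈ dualTensor CA (LinearMap.ker N.mulVecLin))
    (F : (A → ZMod 2) →ₗ[ZMod 2] R) (hF : CA ≤ LinearMap.ker F) (j : ρ) :
    ∑ b, N j b • F (fun a => x (a, b)) = 0 := by
  obtain ⟨c, hc, y, hy, rfl⟩ := Submodule.mem_sup.1 hx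
  have hrow : ∑ b, N j b • (fun a => y (a, b)) = 0 := by
    ext a
    have h : N.mulVecLin (fun b => y (a, b)) = 0 := hy a
    simpa [Matrix.mulVec, dotProduct] using congrFun h j
  have hsplit : ∀ b, F (fun a => (c + y) (a, b)) = F (fun a => y (a, b)) := by
    intro b
    have h : (fun a => (c + y) (a, b)) = (fun a => c (a, b)) + fun a => y (a, b) := rfl
    rw [h, map_add, LinearMap.mem_ker.1 (hF (hc b)), zero_add]
  simp_rw [hsplit, ← map_smul, ← map_sum, hrow, map_zero]

/-- If `z` spans `R`, the matrices all of whose rows are linear relations of `z` form a fraction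
`|R| ^ (-ρ)` of all matrices. -/
theorem card_relation_matrices {ρ B R : Type*} [Fintype ρ] [Fintype B]
    [AddCommGroup R] [Module (ZMod 2) R] (z : B → R)
    (hz : Submodule.span (ZMod 2) (Set.range z) = ⊤) :
    {N : Matrix ρ B (ZMod 2) | ∀ j, ∑ b, N j b • z b = 0}.ncard * Nat.card R ^ Fintype.card ρ
      = Nat.card (Matrix ρ B (ZMod 2)) := by
  set T := Fintype.linearCombination (ZMod 2) z with hT
  have hsurj : Function.Surjective T := by
    rw [← LinearMap.range_eq_top, hT, Fintype.range_linearCombination, hz]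
  have hker : Nat.card (LinearMap.ker T) * Nat.card R = Nat.card (B → ZMod 2) := by
    rw [T.ker.card_eq_card_quotient_mul_card,
      Nat.card_congr (T.quotKerEquivOfSurjective hsurj).toEquiv]
  have hset : {N : Matrix ρ B (ZMod 2) | ∀ j, ∑ b, N j b • z b = 0}.ncard
      = Nat.card (LinearMap.ker T) ^ Fintype.card ρ := by
    rw [← Nat.card_eq_fintype_card, ← Nat.card_fun, ← Nat.card_coe_set_eq]
    exact Nat.card_congr (Equiv.subtypePiEquivPi (p := fun _ u => u ∈ LinearMap.ker T))
  rw [hset, ← mul_pow, hker, ← Nat.card_eq_fintype_card, ← Nat.card_fun]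
  rfl

/-- Probability that some extension of a spanning family `v : Pᶜ → R` to all of `B` is annihilated
by every row of a uniformly random matrix. -/
theorem unifProb_exists_extension_le {ρ B R : Type*} [Fintype ρ] [Fintype B] [DecidableEq ρ]
    [DecidableEq B] [AddCommGroup R] [Module (ZMod 2) R] [Finite R] (P : Finset B)
    (v : {b // b ∉ P} → R) (hv : Submodule.span (ZMod 2) (Set.range v) = ⊤) :
    unifProb {N : Matrix ρ B (ZMod 2) |
        ∃ z : B → R, (∀ b : {b // b ∉ P}, z b = v b) ∧ ∀ j, ∑ b, N j b • z b = 0}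
      ≤ (Nat.card R : ℝ) ^ P.card / (Nat.card R : ℝ) ^ Fintype.card ρ := by
  classical
  have := Fintype.ofFinite R
  have hR : (0 : ℝ) < Nat.card R := by exact_mod_cast Nat.card_pos
  let ext (y : P → R) (b : B) : R := if h : b ∈ P then y ⟨b, h⟩ else v ⟨b, h⟩
  have hext : ∀ y, Submodule.span (ZMod 2) (Set.range (ext y)) = ⊤ := by
    intro y
    refine top_le_iff.1 (hv ▸ Submodule.span_mono ?_)
    rintro _ ⟨b, rfl⟩
    exact ⟨b, dif_neg b.2⟩
  have hsub : {N : Matrix ρ B (ZMod 2) |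
        ∃ z : B → R, (∀ b : {b // b ∉ P}, z b = v b) ∧ ∀ j, ∑ b, N j b • z b = 0}
      ⊆ ⋃ y : P → R, {N | ∀ j, ∑ b, N j b • ext y b = 0} := by
    rintro N ⟨z, hzv, hz⟩
    refine Set.mem_iUnion.2 ⟨fun b => z b, ?_⟩
    have : ext (fun b => z b) = z := by
      funext b
      by_cases h : b ∈ P
      · exact dif_pos h
      · exact (dif_neg h).trans (hzv ⟨b, h⟩).symm
    simpa only [Set.mem_ofPred_eq, this] using hz
  have hcard := ((Set.ncard_le_ncard hsub).trans (Set.ncard_iUnion_le_of_fintype _))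
  have hpos : (0 : ℝ) < Fintype.card (Matrix ρ B (ZMod 2)) := by
    exact_mod_cast Fintype.card_pos
  rw [unifProb, div_le_div_iff₀ hpos (by positivity)]
  have key : ∀ y : P → R,
      ({N : Matrix ρ B (ZMod 2) | ∀ j, ∑ b, N j b • ext y b = 0}.ncard : ℝ)
        * (Nat.card R : ℝ) ^ Fintype.card ρ = Fintype.card (Matrix ρ B (ZMod 2)) := by
    intro y
    rw [← Nat.card_eq_fintype_card (α := Matrix ρ B (ZMod 2))]
    exact_mod_cast card_relation_matrices (ρ := ρ) (ext y) (hext y)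
  calc _ ≤ (∑ y : P → R,
        ({N : Matrix ρ B (ZMod 2) | ∀ j, ∑ b, N j b • ext y b = 0}.ncard : ℝ))
          * (Nat.card R : ℝ) ^ Fintype.card ρ := by
        gcongr
        exact_mod_cast hcard
    _ = _ := by
        rw [Finset.sum_mul, Finset.sum_congr rfl fun y _ => key y]
        simp [Nat.card_eq_fintype_card]

/-- Lemma 10: probability that the dual tensor code with a random
row component code contains a matrix agreeing with a fixed pattern outside `P`. -/
theorem dual_tensor_pattern_probability
    (Δ : ℕ) (hΔ : 2 ≤ Δ) (p rB : ℕ) (hp0 : 0 < p) (hprB : p < rB) (hrBΔ : rB < Δ)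
    (α : ℝ) (hα : 0 < α)
    (d : ℝ) (hd : 2 * α * Δ + 2 * Real.sqrt Δ / Real.logb 2 Δ ≤ d)
    (CA : Submodule (ZMod 2) (Fin Δ → ZMod 2)) (hdA : d ≤ (minDist CA : ℝ))
    (P : Finset (Fin Δ)) (hP : P.card = p)
    (Xp : Matrix (Fin Δ) {b : Fin Δ // b ∉ P} (ZMod 2))
    (hcol : ∀ b : {b : Fin Δ // b ∉ P},
      (wt (fun a => Xp a b) : ℝ) ≤ Real.sqrt Δ / Real.logb 2 Δ)
    (hrows : d / 2 ≤ (({a : Fin Δ | ∃ b, Xp a b ≠ 0}).ncard : ℝ)) :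
    unifProb {N : Matrix (Fin rB) (Fin Δ) (ZMod 2) |
        ∃ x ∈ dualTensor CA (LinearMap.ker N.mulVecLin),
          ∀ (a : Fin Δ) (b : {b : Fin Δ // b ∉ P}), x (a, (b : Fin Δ)) = Xp a b} ≤
      (2 : ℝ) ^ (-(((rB : ℝ) - (p : ℝ)) * (α * Real.sqrt Δ * Real.logb 2 Δ))) := by
  set w : ℝ := Real.sqrt Δ / Real.logb 2 Δ with hwdef
  have hΔ' : (2 : ℝ) ≤ Δ := by exact_mod_cast hΔ
  have hlog : 0 < Real.logb 2 Δ := Real.logb_pos (by norm_num) (by linarith)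
  have hsqrt : 0 < Real.sqrt Δ := Real.sqrt_pos.2 (by linarith)
  have hw : 0 < w := div_pos hsqrt hlog
  have hαw : α * Real.sqrt Δ * Real.logb 2 Δ * w = α * Δ := by
    rw [hwdef]
    field_simp
    rw [Real.sq_sqrt (by linarith)]
  have hαΔ : 0 < α * Δ := by positivity
  have hd' : α * Δ + w ≤ d / 2 := by
    have : 2 * Real.sqrt Δ / Real.logb 2 Δ = 2 * w := by rw [hwdef]; ring
    linarith
  let X : {b : Fin Δ // b ∉ P} → Fin Δ → ZMod 2 := fun b a => Xp a b
  let R := Submodule.span (ZMod 2) (Set.range (CA.mkQ ∘ X))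
  have : Finite ((Fin Δ → ZMod 2) ⧸ CA) := Finite.of_surjective _ CA.mkQ_surjective
  have hrank : α * Real.sqrt Δ * Real.logb 2 Δ ≤ Module.finrank (ZMod 2) R := by
    by_contra! hlt
    have hlt' : (Module.finrank (ZMod 2) R : ℝ) * w < α * Δ :=
      hαw ▸ mul_lt_mul_of_pos_right hlt hw
    have := minDist_le_of_finrank_span_mkQ CA X hcol (by
      change (Module.finrank (ZMod 2) R : ℝ) * w < _
      exact hlt'.trans_le (by change _ ≤ (({a : Fin Δ | ∃ b, Xp a b ≠ 0}).ncard : ℝ); linarith))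
    change (minDist CA : ℝ) ≤ (Module.finrank (ZMod 2) R + 1) * w at this
    linarith
  obtain ⟨π, hπ⟩ := R.subtype.exists_leftInverse_of_injective R.ker_subtype
  let v : {b : Fin Δ // b ∉ P} → R := fun b => ⟨CA.mkQ (X b), Submodule.subset_span ⟨b, rfl⟩⟩
  have hv : Submodule.span (ZMod 2) (Set.range v) = ⊤ := by
    have h := Submodule.span_range_subtype_eq_top_iff R (s := CA.mkQ ∘ X)
      (fun b => Submodule.subset_span ⟨b, rfl⟩)
    exact h.2 rfl
  have hsub : {N : Matrix (Fin rB) (Fin Δ) (ZMod 2) |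
        ∃ x ∈ dualTensor CA (LinearMap.ker N.mulVecLin),
          ∀ (a : Fin Δ) (b : {b : Fin Δ // b ∉ P}), x (a, (b : Fin Δ)) = Xp a b}
      ⊆ {N | ∃ z : Fin Δ → R, (∀ b : {b // b ∉ P}, z b = v b) ∧ ∀ j, ∑ b, N j b • z b = 0} := by
    rintro N ⟨x, hx, hxX⟩
    refine ⟨fun b => (π ∘ₗ CA.mkQ) (fun a => x (a, b)), fun b => ?_, fun j =>
      sum_smul_col_eq_zero_of_mem_dualTensor hx (π ∘ₗ CA.mkQ) ?_ j⟩
    · have hX : (fun a => x (a, (b : Fin Δ))) = X b := funext fun a => hxX a b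
      change (π ∘ₗ CA.mkQ) (fun a => x (a, (b : Fin Δ))) = v b
      rw [hX]
      exact LinearMap.congr_fun hπ (v b)
    · exact CA.ker_mkQ.symm.le.trans (LinearMap.ker_le_ker_comp _ _)
  have hcardR : (Nat.card R : ℝ) = 2 ^ (Module.finrank (ZMod 2) R : ℝ) := by
    rw [Module.natCard_eq_pow_finrank (K := ZMod 2) (V := R)]
    simp
  calc _ ≤ unifProb {N : Matrix (Fin rB) (Fin Δ) (ZMod 2) |
        ∃ z : Fin Δ → R, (∀ b : {b // b ∉ P}, z b = v b) ∧ ∀ j, ∑ b, N j b • z b = 0} := by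
        unfold unifProb
        gcongr
        exact Set.toFinite _
    _ ≤ (Nat.card R : ℝ) ^ P.card / (Nat.card R : ℝ) ^ Fintype.card (Fin rB) :=
        unifProb_exists_extension_le P v hv
    _ = (2 : ℝ) ^ (-(((rB : ℝ) - p) * Module.finrank (ZMod 2) R)) := by
        rw [hP, Fintype.card_fin, hcardR, ← Real.rpow_mul_natCast zero_le_two,
          ← Real.rpow_mul_natCast zero_le_two, ← Real.rpow_sub zero_lt_two]
        congr 1
        ring
    _ ≤ _ := by
        have hpr : (0 : ℝ) ≤ (rB : ℝ) - p := sub_nonneg.2 (by exact_mod_cast hprB.le)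
        refine Real.rpow_le_rpow_of_exponent_le one_le_two ?_
        exact neg_le_neg (mul_le_mul_of_nonneg_left hrank hpr)
end

section
/- Let G be a group and A = A⁻¹, B = B⁻¹ symmetric subsets of G satisfying TNC. Then: (i) for every g ∈ G, a ∈ A, b ∈ B, the four vertices (g,0), (ag,1), (gb,1), (agb,0) of V₀ ∪ V₁ are pairwise distinct; (ii) for every g ∈ G, the map A×B → Q sending (a,b) to the square {(g,0),(ag,1),(gb,1),(agb,0)} is injective, and its image is exactly the set of squares containing the vertex (g,0). -/
section Complex

variable {G : Type*} [Group G] [DecidableEq G]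

theorem mem_cpxSq_false {g a b h : G} : (h, false) ∈ cpxSq g a b ↔ h = g ∨ h = a * g * b := by
  simp [cpxSq]

theorem mem_cpxSq_true {g a b h : G} : (h, true) ∈ cpxSq g a b ↔ h = a * g ∨ h = g * b := by
  simp [cpxSq]

/-- A square can be parametrized from either of its two vertices in `V₀`. -/
theorem cpxSq_opposite (g a b : G) : cpxSq (a * g * b) a⁻¹ b⁻¹ = cpxSq g a b := by
  ext ⟨h, _ | _⟩
  · simp [mem_cpxSq_false, mul_assoc, or_comm]
  · simp [mem_cpxSq_true, mul_assoc, or_comm]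

end Complex

/-- under TNC, each square has four distinct vertices, and the
parametrization of the squares containing a fixed vertex `(g,0)` by `A × B` is a
bijection onto the set of squares containing that vertex. -/
theorem squares_distinct_vertices_and_link_bijection
    {G : Type*} [Group G] [DecidableEq G] (A B : Set G)
    (hA : ∀ a ∈ A, a⁻¹ ∈ A) (hB : ∀ b ∈ B, b⁻¹ ∈ B) (htnc : TNC A B) :
    (∀ g : G, ∀ a ∈ A, ∀ b ∈ B,
      List.Pairwise (· ≠ ·)
        [((g, false) : G × Bool), (a * g, true), (g * b, true), (a * g * b, false)]) ∧
    (∀ g : G,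
      Function.Injective (fun ab : ↥A × ↥B => cpxSq g (ab.1 : G) (ab.2 : G)) ∧
      Set.range (fun ab : ↥A × ↥B => cpxSq g (ab.1 : G) (ab.2 : G)) =
        {q : Finset (G × Bool) | q ∈ Squares A B ∧ ((g, false) : G × Bool) ∈ q}) := by
  have hopp : ∀ g : G, ∀ a ∈ A, ∀ b ∈ B, g ≠ a * g * b := fun g a ha b hb h =>
    htnc g a ha b⁻¹ (hB b hb) (eq_mul_inv_of_mul_eq h.symm)
  refine ⟨fun g a ha b hb => ?_, fun g => ⟨?_, ?_⟩⟩
  · simpa using ⟨hopp g a ha b hb, htnc g a ha b hb⟩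
  · rintro ⟨⟨a, ha⟩, ⟨b, hb⟩⟩ ⟨⟨a', ha'⟩, ⟨b', hb'⟩⟩ h
    have h : cpxSq g a b = cpxSq g a' b' := h
    have hag : (a * g, true) ∈ cpxSq g a' b' := h ▸ mem_cpxSq_true.2 (.inl rfl)
    have hgb : (g * b, true) ∈ cpxSq g a' b' := h ▸ mem_cpxSq_true.2 (.inr rfl)
    obtain rfl : a = a' :=
      mul_right_cancel ((mem_cpxSq_true.1 hag).resolve_right (htnc g a ha b' hb'))
    obtain rfl : b = b' :=
      mul_left_cancel ((mem_cpxSq_true.1 hgb).resolve_left (htnc g a ha b hb).symm)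
    rfl
  · ext q
    constructor
    · rintro ⟨⟨⟨a, ha⟩, ⟨b, hb⟩⟩, rfl⟩
      exact ⟨⟨g, a, ha, b, hb, rfl⟩, mem_cpxSq_false.2 (.inl rfl)⟩
    · rintro ⟨⟨h, a, ha, b, hb, rfl⟩, hg⟩
      obtain rfl | rfl := mem_cpxSq_false.1 hg
      · exact ⟨(⟨a, ha⟩, ⟨b, hb⟩), rfl⟩
      · exact ⟨(⟨a⁻¹, hA a ha⟩, ⟨b⁻¹, hB b hb⟩), cpxSq_opposite h a b⟩
end

section
/- Let C_A ⊆ F₂^A and C_B ⊆ F₂^B be nonzero linear codes of length Δ = |A| = |B| with minimum distances d_A and d_B. Then the minimum distance of the dual tensor code C_A ⊗ F₂^B + F₂^A ⊗ C_B equals min(d_A, d_B). -/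
theorem exists_wt_eq_minDist {ι : Type*} {C : Submodule (ZMod 2) (ι → ZMod 2)} (hC : C ≠ ⊥) :
    ∃ c ∈ C, c ≠ 0 ∧ wt c = minDist C := by
  obtain ⟨c, hc, h0⟩ := C.ne_bot_iff.mp hC
  exact Nat.sInf_mem (s := {d : ℕ | ∃ c ∈ C, c ≠ 0 ∧ wt c = d}) ⟨wt c, c, hc, h0, rfl⟩

/-- If every support index of `x` is the image under `g` of a support index of `y`, then `x` has
weight at most that of `y`. -/
theorem wt_le_wt_of_surjOn {ι κ : Type*} [Finite κ] {x : ι → ZMod 2} {y : κ → ZMod 2}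
    (g : κ → ι) (h : ∀ i, x i ≠ 0 → ∃ k, y k ≠ 0 ∧ g k = i) : wt x ≤ wt y :=
  (Set.ncard_le_ncard (t := g '' {k | y k ≠ 0}) (fun i hi => h i hi) (Set.toFinite _)).trans
    (Set.ncard_image_le (Set.toFinite _))

/-- A functional vanishing on `CB`, applied to each row of a word of the dual tensor code, gives a
word of `CA`. -/
theorem apply_row_mem_of_mem_dualTensor {A B : Type*} [Finite B]
    {CA : Submodule (ZMod 2) (A → ZMod 2)} {CB : Submodule (ZMod 2) (B → ZMod 2)}
    {x : A × B → ZMod 2} (hx : x ∈ dualTensor CA CB) (f : (B → ZMod 2) →ₗ[ZMod 2] ZMod 2)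
    (hf : ∀ c ∈ CB, f c = 0) : (fun a => f fun b => x (a, b)) ∈ CA := by
  classical
  have := Fintype.ofFinite B
  obtain ⟨y, hy, z, hz, rfl⟩ := Submodule.mem_sup.mp hx
  have key : (fun a => f fun b => (y + z) (a, b)) =
      ∑ b, f (Pi.single b 1) • fun a => y (a, b) := by
    funext a
    have hadd : f (fun b => (y + z) (a, b)) = f (fun b => y (a, b)) + f (fun b => z (a, b)) :=
      map_add f (fun b => y (a, b)) fun b => z (a, b)
    rw [hadd, hf _ (hz a), add_zero, LinearMap.pi_apply_eq_sum_univ f fun b => y (a, b)]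
    simp only [Finset.sum_apply, Pi.smul_apply, smul_eq_mul]
    refine Finset.sum_congr rfl fun b _ => ?_
    rw [mul_comm]
    congr 2
    funext j
    simp [Pi.single_apply, eq_comm]
  rw [key]
  exact CA.sum_mem fun b _ => CA.smul_mem _ (hy b)

theorem min_minDist_le_wt_of_mem_dualTensor {A B : Type*} [Finite A] [Finite B]
    {CA : Submodule (ZMod 2) (A → ZMod 2)} {CB : Submodule (ZMod 2) (B → ZMod 2)}
    {x : A × B → ZMod 2} (hx : x ∈ dualTensor CA CB) (h0 : x ≠ 0) :
    min (minDist CA) (minDist CB) ≤ wt x := by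
  by_cases hrow : ∀ a, (fun b => x (a, b)) ∈ CB
  · obtain ⟨⟨a, b⟩, hab⟩ := Function.ne_iff.mp h0
    have hne : (fun b => x (a, b)) ≠ 0 := Function.ne_iff.mpr ⟨b, hab⟩
    exact (min_le_right _ _).trans <| (minDist_le_wt (hrow a) hne).trans <|
      wt_le_wt_of_surjOn Prod.snd fun b hb => ⟨(a, b), hb, rfl⟩
  · push Not at hrow
    obtain ⟨a, ha⟩ := hrow
    obtain ⟨f, hfa, hf⟩ := Submodule.exists_le_ker_of_notMem ha
    have hne : (fun a => f fun b => x (a, b)) ≠ 0 := Function.ne_iff.mpr ⟨a, hfa⟩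
    refine (min_le_left _ _).trans <|
      (minDist_le_wt (apply_row_mem_of_mem_dualTensor hx f fun c hc => hf hc) hne).trans <|
      wt_le_wt_of_surjOn Prod.fst fun a' ha' => ?_
    by_contra! h
    refine ha' ?_
    have hzero : (fun b => x (a', b)) = 0 := by
      funext b
      by_contra hb
      exact h (a', b) hb rfl
    simp only [hzero, map_zero]

theorem minDist_dualTensor_le_left {A B : Type*} [Finite A] [Nonempty B]
    {CA : Submodule (ZMod 2) (A → ZMod 2)} (CB : Submodule (ZMod 2) (B → ZMod 2))
    (hCA : CA ≠ ⊥) : minDist (dualTensor CA CB) ≤ minDist CA := by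
  classical
  obtain ⟨c, hc, h0, hw⟩ := exists_wt_eq_minDist hCA
  obtain ⟨b₀⟩ := ‹Nonempty B›
  let x : A × B → ZMod 2 := fun p => if p.2 = b₀ then c p.1 else 0
  have hx : x ∈ dualTensor CA CB := by
    refine Submodule.mem_sup_left fun b => ?_
    by_cases hb : b = b₀
    · simpa [x, hb] using hc
    · simp only [x, hb, if_false]
      exact CA.zero_mem
  obtain ⟨a, ha⟩ := Function.ne_iff.mp h0
  have hx0 : x ≠ 0 := Function.ne_iff.mpr ⟨(a, b₀), by simpa [x] using ha⟩
  rw [← hw]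
  refine (minDist_le_wt hx hx0).trans <|
    wt_le_wt_of_surjOn (fun a => (a, b₀)) fun p hp => ?_
  obtain ⟨hb, hcp⟩ : p.2 = b₀ ∧ c p.1 ≠ 0 := by simpa [x] using hp
  exact ⟨p.1, hcp, Prod.ext rfl hb.symm⟩

theorem minDist_dualTensor_le_right {A B : Type*} [Nonempty A] [Finite B]
    (CA : Submodule (ZMod 2) (A → ZMod 2)) {CB : Submodule (ZMod 2) (B → ZMod 2)}
    (hCB : CB ≠ ⊥) : minDist (dualTensor CA CB) ≤ minDist CB := by
  classical
  obtain ⟨c, hc, h0, hw⟩ := exists_wt_eq_minDist hCB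
  obtain ⟨a₀⟩ := ‹Nonempty A›
  let x : A × B → ZMod 2 := fun p => if p.1 = a₀ then c p.2 else 0
  have hx : x ∈ dualTensor CA CB := by
    refine Submodule.mem_sup_right fun a => ?_
    by_cases ha : a = a₀
    · simpa [x, ha] using hc
    · simp only [x, ha, if_false]
      exact CB.zero_mem
  obtain ⟨b, hb⟩ := Function.ne_iff.mp h0
  have hx0 : x ≠ 0 := Function.ne_iff.mpr ⟨(a₀, b), by simpa [x] using hb⟩
  rw [← hw]
  refine (minDist_le_wt hx hx0).trans <|
    wt_le_wt_of_surjOn (fun b => (a₀, b)) fun p hp => ?_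
  obtain ⟨ha, hcp⟩ : p.1 = a₀ ∧ c p.2 ≠ 0 := by simpa [x] using hp
  exact ⟨p.2, hcp, Prod.ext ha.symm rfl⟩

theorem nonempty_of_code_ne_bot {ι : Type*} {C : Submodule (ZMod 2) (ι → ZMod 2)} (hC : C ≠ ⊥) :
    Nonempty ι := by
  by_contra h
  rw [not_nonempty_iff] at h
  exact hC (Subsingleton.elim _ _)

/-- the minimum distance of the dual tensor code is
`min(d_A, d_B)`. -/
theorem dual_tensor_min_distance
    {A B : Type*} [Finite A] [Finite B] (Δ : ℕ)
    (hcA : Nat.card A = Δ) (hcB : Nat.card B = Δ)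
    (CA : Submodule (ZMod 2) (A → ZMod 2)) (CB : Submodule (ZMod 2) (B → ZMod 2))
    (hCA : CA ≠ ⊥) (hCB : CB ≠ ⊥) :
    minDist (dualTensor CA CB) = min (minDist CA) (minDist CB) := by
  have := nonempty_of_code_ne_bot hCA
  have := nonempty_of_code_ne_bot hCB
  refine le_antisymm
    (le_min (minDist_dualTensor_le_left CB hCA) (minDist_dualTensor_le_right CA hCB)) ?_
  have hne : dualTensor CA CB ≠ ⊥ := by
    obtain ⟨c, hc, h0⟩ := CA.ne_bot_iff.mp hCA
    obtain ⟨a, ha⟩ := Function.ne_iff.mp h0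
    obtain ⟨b⟩ := ‹Nonempty B›
    have hx : (fun p : A × B => c p.1) ∈ dualTensor CA CB := Submodule.mem_sup_left fun _ => hc
    exact (Submodule.ne_bot_iff _).mpr ⟨_, hx, Function.ne_iff.mpr ⟨(a, b), ha⟩⟩
  obtain ⟨x, hx, h0, hw⟩ := exists_wt_eq_minDist hne
  exact hw ▸ min_minDist_le_wt_of_mem_dualTensor hx h0
end
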